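/- Let σ_x ≥ σ_y > 0, σ_{k,x} ≥ σ_{k,y} > 0, μ_k ∈ ℝ², θ_k ∈ ℝ, and let π_k > 0 and ω > 0 be scalar weights. Define C(x_s, θ_s) = π_k ( ln(π_k/ω) + F(x_s, θ_s) ), where F(x_s, θ_s) = (1/2)( ln( det Σ(θ_s)/det Σ_k ) + (x_s − μ_k)ᵀ Σ(θ_s)⁻¹ (x_s − μ_k) + tr( Σ(θ_s)⁻¹ Σ_k ) − 2 ). Then C attains its global minimum at (μ_k, θ_k), and the minimum value equals C* = π_k ( ln(π_k/ω) + (1/2)( ln( σ_x σ_y / (σ_{k,x} σ_{k,y}) ) + (σ_{k,x} σ_y + σ_{k,y} σ_x)/(σ_x σ_y) − 2 ) ). -/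

import Mathlib

open Real Matrix

/-- The 2×2 rotation matrix. -/
noncomputable def rot (θ : ℝ) : Matrix (Fin 2) (Fin 2) ℝ :=
  !![Real.cos θ, -Real.sin θ; Real.sin θ, Real.cos θ]

theorem rot_mul_rot_transpose (θ : ℝ) : rot θ * (rot θ)ᵀ = 1 := by
  have h := Real.sin_sq_add_cos_sq θ
  ext i j
  fin_cases i <;> fin_cases j <;> simp [rot, Matrix.mul_apply, Fin.sum_univ_two] <;> nlinarith

theorem rot_transpose_mul_rot (θ : ℝ) : (rot θ)ᵀ * rot θ = 1 :=
  mul_eq_one_comm.mp (rot_mul_rot_transpose θ)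

theorem det_rot_conj (a b θ : ℝ) : (rot θ * !![a, 0; 0, b] * (rot θ)ᵀ).det = a * b := by
  rw [det_mul, det_mul, mul_right_comm, ← det_mul, rot_mul_rot_transpose]
  simp [det_fin_two]

theorem inv_rot_conj {a b : ℝ} (ha : a ≠ 0) (hb : b ≠ 0) (θ : ℝ) :
    (rot θ * !![a, 0; 0, b] * (rot θ)ᵀ)⁻¹ = rot θ * !![a⁻¹, 0; 0, b⁻¹] * (rot θ)ᵀ := by
  apply Matrix.inv_eq_right_inv
  have hd : !![a, 0; 0, b] * !![a⁻¹, 0; 0, b⁻¹] = 1 := by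
    ext i j
    fin_cases i <;> fin_cases j <;> simp [ha, hb]
  calc
    _ = rot θ * !![a, 0; 0, b] * ((rot θ)ᵀ * rot θ) * !![a⁻¹, 0; 0, b⁻¹] * (rot θ)ᵀ := by
      simp only [Matrix.mul_assoc]
    _ = 1 := by
      rw [rot_transpose_mul_rot, Matrix.mul_one, Matrix.mul_assoc (rot θ), hd, Matrix.mul_one,
        rot_mul_rot_transpose]

theorem trace_rot_conj_mul_rot_conj (a b c d θ φ : ℝ) :
    ((rot θ * !![a, 0; 0, b] * (rot θ)ᵀ) * (rot φ * !![c, 0; 0, d] * (rot φ)ᵀ)).trace =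
      Real.cos (θ - φ) ^ 2 * (a * c + b * d) + Real.sin (θ - φ) ^ 2 * (a * d + b * c) := by
  rw [trace_fin_two, Real.cos_sub, Real.sin_sub]
  simp only [Matrix.mul_apply, Fin.sum_univ_two]
  simp [rot]
  ring

theorem dotProduct_rot_conj_mulVec_nonneg {a b : ℝ} (ha : 0 ≤ a) (hb : 0 ≤ b) (θ : ℝ)
    (v : Fin 2 → ℝ) : 0 ≤ v ⬝ᵥ ((rot θ * !![a, 0; 0, b] * (rot θ)ᵀ) *ᵥ v) := by
  have h : v ⬝ᵥ ((rot θ * !![a, 0; 0, b] * (rot θ)ᵀ) *ᵥ v) =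
      a * (Real.cos θ * v 0 + Real.sin θ * v 1) ^ 2 +
        b * (Real.cos θ * v 1 - Real.sin θ * v 0) ^ 2 := by
    simp [rot, Matrix.mul_apply, Fin.sum_univ_two, dotProduct, mulVec]
    ring
  rw [h]
  positivity

theorem stmt1 (σx σy σkx σky : ℝ) (h1 : σx ≥ σy) (h2 : σy > 0)
    (h3 : σkx ≥ σky) (h4 : σky > 0)
    (μk : Fin 2 → ℝ) (θk : ℝ)
    (πk ω : ℝ) (hπ : πk > 0) (hω : ω > 0)
    (Sig : ℝ → Matrix (Fin 2) (Fin 2) ℝ)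
    (hSig : ∀ θs, Sig θs = rot θs * !![σx, 0; 0, σy] * (rot θs)ᵀ)
    (Sigk : Matrix (Fin 2) (Fin 2) ℝ)
    (hSigk : Sigk = rot θk * !![σkx, 0; 0, σky] * (rot θk)ᵀ)
    (F : (Fin 2 → ℝ) → ℝ → ℝ)
    (hF : ∀ xs θs, F xs θs = (1 / 2) * (Real.log ((Sig θs).det / Sigk.det)
      + (xs - μk) ⬝ᵥ ((Sig θs)⁻¹ *ᵥ (xs - μk))
      + ((Sig θs)⁻¹ * Sigk).trace - 2))
    (C : (Fin 2 → ℝ) → ℝ → ℝ)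
    (hC : ∀ xs θs, C xs θs = πk * (Real.log (πk / ω) + F xs θs)) :
    (∀ (xs : Fin 2 → ℝ) (θs : ℝ), C μk θk ≤ C xs θs) ∧
    C μk θk = πk * (Real.log (πk / ω)
      + (1 / 2) * (Real.log (σx * σy / (σkx * σky))
        + (σkx * σy + σky * σx) / (σx * σy) - 2)) := by
  have hx : 0 < σx := h2.trans_le h1
  have hdet : ∀ θs, (Sig θs).det / Sigk.det = σx * σy / (σkx * σky) := fun θs => by
    rw [hSig, hSigk, det_rot_conj, det_rot_conj]
  have hinv : ∀ θs, (Sig θs)⁻¹ = rot θs * !![σx⁻¹, 0; 0, σy⁻¹] * (rot θs)ᵀ := fun θs => by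
    rw [hSig, inv_rot_conj hx.ne' h2.ne']
  have htr : ((Sig θk)⁻¹ * Sigk).trace = σx⁻¹ * σkx + σy⁻¹ * σky := by
    rw [hinv, hSigk, trace_rot_conj_mul_rot_conj]
    simp
  refine ⟨fun xs θs => ?_, ?_⟩
  · have hquad : 0 ≤ (xs - μk) ⬝ᵥ ((Sig θs)⁻¹ *ᵥ (xs - μk)) := by
      rw [hinv]
      exact dotProduct_rot_conj_mulVec_nonneg (inv_nonneg.mpr hx.le) (inv_nonneg.mpr h2.le) _ _
    have hle : ((Sig θk)⁻¹ * Sigk).trace ≤ ((Sig θs)⁻¹ * Sigk).trace := by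
      rw [htr, hinv, hSigk, trace_rot_conj_mul_rot_conj, Real.cos_sq']
      have hxy : σx⁻¹ ≤ σy⁻¹ := inv_anti₀ h2 h1
      have hprod := mul_nonneg (sq_nonneg (Real.sin (θs - θk)))
        (mul_nonneg (sub_nonneg.mpr hxy) (sub_nonneg.mpr h3))
      linarith
    rw [hC, hC, hF, hF, hdet, hdet, sub_self, zero_dotProduct]
    gcongr
  · have hval : σx⁻¹ * σkx + σy⁻¹ * σky = (σkx * σy + σky * σx) / (σx * σy) := by
      field_simp
    rw [hC, hF, hdet, htr, sub_self, zero_dotProduct, add_zero, hval]
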